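/- Over the alphabet A = {0, 1}, the language WMIX(0, 1, 00, 11) = { w ∈ {0,1}* : |w|_0 = |w|_1 = |w|_{00} = |w|_{11} } is finite. -/

import Mathlib

/-- `occ w u` is the number of occurrences of `u` as a contiguous factor of `w`. -/
noncomputable def occ {A : Type*} (w u : List A) : ℕ :=
  Nat.card {p : List A × List A // p.1 ++ u ++ p.2 = w}

/-- letter `0` of the alphabet `{0,1}`, modelled by `Bool`. -/
def l0 : Bool := false
/-- letter `1` of the alphabet `{0,1}`, modelled by `Bool`. -/
def l1 : Bool := true

theorem occ_finite {A : Type*} (w u : List A) :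
    Finite {p : List A × List A // p.1 ++ u ++ p.2 = w} := by
  refine Finite.of_injective (β := Fin (w.length + 1))
    (fun p => ⟨p.1.1.length, by
      have := congrArg List.length p.2
      simp only [List.length_append] at this
      omega⟩) ?_
  rintro ⟨⟨p1, p2⟩, hp⟩ ⟨⟨q1, q2⟩, hq⟩ h
  simp only [Fin.mk.injEq] at h
  simp only at hp hq
  rw [← hq, List.append_assoc, List.append_assoc] at hp
  obtain ⟨h1, h2⟩ := List.append_inj hp h
  have h3 := List.append_cancel_left h2
  subst h1 h3
  rfl

theorem occ_lt {A : Type*} (w : List A) (a : A) (h : a ∈ w) : occ w [a, a] < occ w [a] := by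
  obtain ⟨s, t, hw, hs⟩ := List.eq_append_cons_of_mem h
  have := occ_finite w [a]
  have := occ_finite w [a, a]
  unfold occ
  let f : {p : List A × List A // p.1 ++ [a, a] ++ p.2 = w} →
      {p : List A × List A // p.1 ++ [a] ++ p.2 = w} :=
    fun p => ⟨(p.1.1 ++ [a], p.1.2), by simpa using p.2⟩
  have hf : Function.Injective f := by
    rintro ⟨⟨p1, p2⟩, hp⟩ ⟨⟨q1, q2⟩, hq⟩ h
    simpa [f] using h
  have := Fintype.ofFinite {p : List A × List A // p.1 ++ [a] ++ p.2 = w}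
  have := Fintype.ofFinite {p : List A × List A // p.1 ++ [a, a] ++ p.2 = w}
  rw [Nat.card_eq_fintype_card, Nat.card_eq_fintype_card]
  refine Fintype.card_lt_of_injective_of_notMem f hf (b := ⟨(s, t), by simp [hw]⟩) ?_
  rintro ⟨⟨⟨p1, p2⟩, hp⟩, h⟩
  simp only [f, Subtype.mk.injEq, Prod.mk.injEq] at h
  apply hs
  rw [← h.1]
  simp

theorem wmix_0_1_00_11_finite :
    {w : List Bool | occ w [l0] = occ w [l1] ∧ occ w [l1] = occ w [l0, l0] ∧
      occ w [l0, l0] = occ w [l1, l1]}.Finite := by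
  refine (Set.finite_singleton []).subset ?_
  rintro w ⟨h1, h2, h3⟩
  rcases w with _ | ⟨b, w⟩
  · rfl
  · exfalso
    have := occ_lt (b :: w) b (by simp)
    cases b
    · change occ _ [l0, l0] < occ _ [l0] at this
      omega
    · change occ _ [l1, l1] < occ _ [l1] at this
      omega
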